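/- arXiv:1606.06807 — 3 statements merged into one kernel-verified Lean document; each statement's English description precedes it below -/
import Mathlib

section
/- Let p be a prime and let R be either the field ℚ of rational numbers or the field ℤ_p = ℤ/pℤ of p elements. If Γ is a poly-torsion-free-abelian (PTFA) group, then the group ring RΓ is an integral domain: RΓ is a nontrivial ring with no zero divisors. -/
/-- A group `Γ` is poly-torsion-free-abelian (PTFA) if it admits a finite subnormal chain
`{1} = Γ_k ⊴ Γ_{k-1} ⊴ ⋯ ⊴ Γ_0 = Γ` (here `s i` is `Γ_i`) such that each `Γ_{i+1}` is normal
in `Γ_i` and each successive quotient `Γ_i/Γ_{i+1}` is abelian and torsion-free (all conditions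
expressed elementwise). -/
def IsPTFA (Γ : Type*) [Group Γ] : Prop :=
  ∃ (k : ℕ) (s : ℕ → Subgroup Γ),
    s 0 = ⊤ ∧ s k = ⊥ ∧
    (∀ i, i < k → s (i + 1) ≤ s i) ∧
    -- `Γ_{i+1}` is normal in `Γ_i`
    (∀ i, i < k → ∀ x ∈ s i, ∀ y ∈ s (i + 1), x * y * x⁻¹ ∈ s (i + 1)) ∧
    -- the quotient `Γ_i/Γ_{i+1}` is abelian
    (∀ i, i < k → ∀ x ∈ s i, ∀ y ∈ s i, x * y * x⁻¹ * y⁻¹ ∈ s (i + 1)) ∧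
    -- the quotient `Γ_i/Γ_{i+1}` is torsion-free
    (∀ i, i < k → ∀ x ∈ s i, ∀ m : ℕ, 0 < m → x ^ m ∈ s (i + 1) → x ∈ s (i + 1))

/-- A torsion-free abelian group has unique products. -/
theorem UniqueProds.of_isMulTorsionFree (G : Type*) [CommGroup G] [IsMulTorsionFree G] :
    UniqueProds G :=
  have : UniqueSums (Additive G) :=
    UniqueSums.of_injective_addHom (DivisibleHull.coeAddMonoidHom (Additive G)).toAddHom
      (DivisibleHull.coe_injective (M := Additive G)) inferInstance
  (MulEquiv.multiplicativeAdditive G).uniqueProds_iff.mp inferInstance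

/-- An extension of groups with unique products has unique products. -/
theorem UniqueProds.of_ker {G Q : Type*} [Group G] [Group Q] (f : G →* Q)
    (hK : UniqueProds f.ker) (hQ : UniqueProds Q) : UniqueProds G where
  uniqueMul_of_nonempty {A B} hA hB := by
    classical
    obtain ⟨q, hq, r, hr, hqr⟩ := hQ.uniqueMul_of_nonempty (hA.image f) (hB.image f)
    obtain ⟨a₁, ha₁, rfl⟩ := Finset.mem_image.mp hq
    obtain ⟨b₁, hb₁, rfl⟩ := Finset.mem_image.mp hr
    -- Translate the parts of `A` and `B` over the unique pair into the kernel.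
    let u : f.ker ↪ G := ⟨fun x ↦ a₁ * x, fun x y h ↦ Subtype.ext (mul_left_cancel h)⟩
    let v : f.ker ↪ G := ⟨fun x ↦ x * b₁, fun x y h ↦ Subtype.ext (mul_right_cancel h)⟩
    have hu (x) : u x = a₁ * x := rfl
    have hv (x) : v x = x * b₁ := rfl
    obtain ⟨c, hc, d, hd, hcd⟩ := hK.uniqueMul_of_nonempty
      (A := A.preimage u u.injective.injOn) (B := B.preimage v v.injective.injOn)
      ⟨1, Finset.mem_preimage.mpr (by simpa only [hu, OneMemClass.coe_one, mul_one] using ha₁)⟩ ⟨1, Finset.mem_preimage.mpr (by simpa only [hv, OneMemClass.coe_one, one_mul] using hb₁)⟩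
    have hc' : f c = 1 := c.2
    have hd' : f d = 1 := d.2
    rw [Finset.mem_preimage] at hc hd
    refine ⟨u c, hc, v d, hd, UniqueMul.of_image_filter (f : G →ₙ* Q)
      (by simp [hu, hc']) (by simp [hv, hd']) hqr ?_⟩
    intro a b ha hb hab
    obtain ⟨ha, hfa⟩ := Finset.mem_filter.mp ha
    obtain ⟨hb, hfb⟩ := Finset.mem_filter.mp hb
    obtain ⟨x, rfl⟩ : ∃ x, u x = a :=
      ⟨⟨a₁⁻¹ * a, by simp_all [MonoidHom.mem_ker]⟩, mul_inv_cancel_left a₁ a⟩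
    obtain ⟨y, rfl⟩ : ∃ y, v y = b :=
      ⟨⟨b * b₁⁻¹, by simp_all [MonoidHom.mem_ker]⟩, inv_mul_cancel_right b b₁⟩
    have hxy : x * y = c * d := Subtype.ext <| mul_left_cancel (a := a₁) <|
      mul_right_cancel (b := b₁) <| by simpa [hu, hv, mul_assoc] using hab
    obtain ⟨rfl, rfl⟩ := hcd (Finset.mem_preimage.mpr ha) (Finset.mem_preimage.mpr hb) hxy
    exact ⟨rfl, rfl⟩

/-- A group is a unique product group if it has a normal unique product subgroup with
torsion-free abelian quotient. -/
theorem UniqueProds.of_normal_subgroup {G : Type*} [Group G] (N : Subgroup G) [N.Normal]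
    (hN : UniqueProds N) (hcomm : ∀ x y : G, x * y * x⁻¹ * y⁻¹ ∈ N)
    (htf : ∀ (x : G) (m : ℕ), 0 < m → x ^ m ∈ N → x ∈ N) : UniqueProds G := by
  let _ : CommGroup (G ⧸ N) :=
    { (inferInstance : Group (G ⧸ N)) with
      mul_comm := by
        rintro ⟨x⟩ ⟨y⟩
        have h : ((x * y * x⁻¹ * y⁻¹ : G) : G ⧸ N) = 1 :=
          (QuotientGroup.eq_one_iff _).mpr (hcomm x y)
        change (x * y : G ⧸ N) = y * x
        simpa [mul_inv_eq_iff_eq_mul] using h }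
  have : IsMulTorsionFree (G ⧸ N) := by
    refine isMulTorsionFree_iff_not_isOfFinOrder.mpr ?_
    rintro ⟨x⟩ hx hfin
    obtain ⟨m, hm, h⟩ := isOfFinOrder_iff_pow_eq_one.mp hfin
    exact hx ((QuotientGroup.eq_one_iff x).mpr
      (htf x m hm ((QuotientGroup.eq_one_iff (x ^ m)).mp h)))
  have hQ : UniqueProds (G ⧸ N) := UniqueProds.of_isMulTorsionFree _
  exact UniqueProds.of_ker (QuotientGroup.mk' N) (by rwa [QuotientGroup.ker_mk']) hQ

/-- PTFA groups have unique products. -/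
theorem IsPTFA.uniqueProds {Γ : Type*} [Group Γ] (hΓ : IsPTFA Γ) : UniqueProds Γ := by
  obtain ⟨k, s, h0, hk, hle, hnormal, hcomm, htf⟩ := hΓ
  have key : UniqueProds (s 0) := by
    refine Nat.decreasingInduction (motive := fun i _ ↦ UniqueProds (s i)) ?_ ?_ (Nat.zero_le k)
    · intro i hi ih
      let N := (s (i + 1)).subgroupOf (s i)
      have : N.Normal := ⟨fun y hy x ↦ hnormal i hi x x.2 y hy⟩
      exact UniqueProds.of_normal_subgroup N
        ((Subgroup.subgroupOfEquivOfLe (hle i hi)).uniqueProds_iff.mpr ih)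
        (fun x y ↦ hcomm i hi x x.2 y y.2) (fun x m hm h ↦ htf i hi x x.2 m hm h)
    · rw [hk]
      exact ⟨fun {A B} ⟨a, ha⟩ ⟨b, hb⟩ ↦ ⟨a, ha, b, hb, UniqueMul.of_subsingleton⟩⟩
  rw [h0] at key
  exact Subgroup.topEquiv.uniqueProds_iff.mp key

/-- If `Γ` is PTFA and `R = ℚ` or `R = ℤ/pℤ` (`p` prime), then the group ring `RΓ`
(the monoid algebra of `Γ` over `R`) is a nontrivial ring with no zero divisors. -/
theorem ptfa_groupRing_isDomain (p : ℕ) (hp : Nat.Prime p)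
    (Γ : Type*) [Group Γ] (hΓ : IsPTFA Γ) :
    (Nontrivial (MonoidAlgebra ℚ Γ) ∧ NoZeroDivisors (MonoidAlgebra ℚ Γ)) ∧
    (Nontrivial (MonoidAlgebra (ZMod p) Γ) ∧ NoZeroDivisors (MonoidAlgebra (ZMod p) Γ)) := by
  have := hΓ.uniqueProds
  have : Fact p.Prime := ⟨hp⟩
  exact ⟨⟨inferInstance, inferInstance⟩, inferInstance, inferInstance⟩
end

section
/- For every group G and every natural number n, the n-th term G^{(n)}_r of the rational derived series of G is a normal subgroup of G, and the quotient group G/G^{(n)}_r is poly-torsion-free-abelian (PTFA). -/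
/-- The kernel of the natural homomorphism `N → (N/[N,N]) ⊗_ℤ R`, i.e. of the abelianization
map followed by `x ↦ x ⊗ 1`, as a subgroup of `N`. -/
def tensorKernel (N : Type*) [Group N] (R : Type*) [CommRing R] : Subgroup N where
  carrier := {x : N |
    (Additive.ofMul (Abelianization.of x) ⊗ₜ[ℤ] (1 : R) :
      TensorProduct ℤ (Additive (Abelianization N)) R) = 0}
  one_mem' := by
    simp only [Set.mem_setOf_eq, map_one, ofMul_one, TensorProduct.zero_tmul]
  mul_mem' := by
    intro a b ha hb
    simp only [Set.mem_setOf_eq] at ha hb ⊢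
    rw [map_mul, ofMul_mul, TensorProduct.add_tmul, ha, hb, add_zero]
  inv_mem' := by
    intro a ha
    simp only [Set.mem_setOf_eq] at ha ⊢
    rw [map_inv, ofMul_inv, TensorProduct.neg_tmul, ha, neg_zero]

/-- The rational derived series of `G`: `G^{(0)}_r = G`, and `G^{(n+1)}_r` is the kernel of the
natural homomorphism `G^{(n)}_r → (G^{(n)}_r/[G^{(n)}_r, G^{(n)}_r]) ⊗_ℤ ℚ`. -/
def rationalDerivedSeries (G : Type*) [Group G] : ℕ → Subgroup G
  | 0 => ⊤
  | n + 1 =>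
      Subgroup.map (rationalDerivedSeries G n).subtype
        (tensorKernel (rationalDerivedSeries G n) ℚ)

theorem mem_tensorKernel {N : Type*} [Group N] {R : Type*} [CommRing R] {x : N} :
    x ∈ tensorKernel N R ↔
      (Additive.ofMul (Abelianization.of x) ⊗ₜ[ℤ] (1 : R) :
        TensorProduct ℤ (Additive (Abelianization N)) R) = 0 :=
  Iff.rfl

/-- The subgroups `tensorKernel N R` are functorial in `N`. -/
theorem map_mem_tensorKernel {N M : Type*} [Group N] [Group M] {R : Type*} [CommRing R]
    (f : N →* M) {x : N} (hx : x ∈ tensorKernel N R) : f x ∈ tensorKernel M R := by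
  rw [mem_tensorKernel] at hx ⊢
  simpa using congrArg
    (LinearMap.rTensor R (MonoidHom.toAdditive (Abelianization.map f)).toIntLinearMap) hx

theorem commutator_mem_tensorKernel {N : Type*} [Group N] {R : Type*} [CommRing R] (x y : N) :
    x * y * x⁻¹ * y⁻¹ ∈ tensorKernel N R := by
  have h : Abelianization.of (x * y * x⁻¹ * y⁻¹) = 1 := by
    simp only [map_mul, map_inv]
    rw [mul_comm (Abelianization.of x), mul_inv_cancel_right, mul_inv_cancel]
  rw [mem_tensorKernel, h, ofMul_one, TensorProduct.zero_tmul]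

theorem mem_tensorKernel_rat_of_pow_mem {N : Type*} [Group N] {x : N} {m : ℕ} (hm : 0 < m)
    (hx : x ^ m ∈ tensorKernel N ℚ) : x ∈ tensorKernel N ℚ := by
  rw [mem_tensorKernel] at hx ⊢
  rw [map_pow, ofMul_pow, ← TensorProduct.smul_tmul', ← TensorProduct.tmul_smul] at hx
  have hm' : (m : ℚ) ≠ 0 := by exact_mod_cast hm.ne'
  simpa [hm'] using congrArg
    (LinearMap.lTensor (Additive (Abelianization N)) (LinearMap.mulLeft ℤ ((m : ℚ)⁻¹))) hx

theorem mem_rationalDerivedSeries_succ {G : Type*} [Group G] {n : ℕ} {x : G} :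
    x ∈ rationalDerivedSeries G (n + 1) ↔
      ∃ h : x ∈ rationalDerivedSeries G n,
        (⟨x, h⟩ : rationalDerivedSeries G n) ∈ tensorKernel (rationalDerivedSeries G n) ℚ := by
  simp [rationalDerivedSeries, Subgroup.mem_map]

theorem rationalDerivedSeries_antitone (G : Type*) [Group G] :
    Antitone (rationalDerivedSeries G) :=
  antitone_nat_of_succ_le fun _ _ hx => (mem_rationalDerivedSeries_succ.1 hx).1

theorem rationalDerivedSeries_normal (G : Type*) [Group G] (n : ℕ) :
    (rationalDerivedSeries G n).Normal := by
  induction n with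
  | zero => exact Subgroup.normal_of_characteristic (⊤ : Subgroup G)
  | succ n ih =>
    refine ⟨fun x hx g => ?_⟩
    obtain ⟨h, hk⟩ := mem_rationalDerivedSeries_succ.1 hx
    exact mem_rationalDerivedSeries_succ.2 ⟨ih.conj_mem x h g,
      map_mem_tensorKernel (MulAut.conjNormal g : MulAut (rationalDerivedSeries G n)).toMonoidHom
        hk⟩

theorem commutator_mem_rationalDerivedSeries_succ {G : Type*} [Group G] {n : ℕ} {x y : G}
    (hx : x ∈ rationalDerivedSeries G n) (hy : y ∈ rationalDerivedSeries G n) :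
    x * y * x⁻¹ * y⁻¹ ∈ rationalDerivedSeries G (n + 1) :=
  mem_rationalDerivedSeries_succ.2 ⟨_, commutator_mem_tensorKernel
    (⟨x, hx⟩ : rationalDerivedSeries G n) ⟨y, hy⟩⟩

theorem mem_rationalDerivedSeries_succ_of_pow_mem {G : Type*} [Group G] {n m : ℕ} {x : G}
    (hm : 0 < m) (hx : x ∈ rationalDerivedSeries G n)
    (hxm : x ^ m ∈ rationalDerivedSeries G (n + 1)) : x ∈ rationalDerivedSeries G (n + 1) := by
  obtain ⟨_, hk⟩ := mem_rationalDerivedSeries_succ.1 hxm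
  exact mem_rationalDerivedSeries_succ.2 ⟨hx, mem_tensorKernel_rat_of_pow_mem hm hk⟩

/-- For every group `G` and every `n`, the subgroup `G^{(n)}_r` is normal in `G` and the
quotient `G/G^{(n)}_r` is PTFA. -/
theorem rationalDerivedSeries_normal_and_quotient_ptfa (G : Type*) [Group G] (n : ℕ) :
    ∃ _ : (rationalDerivedSeries G n).Normal,
      IsPTFA (G ⧸ rationalDerivedSeries G n) := by
  have hn := rationalDerivedSeries_normal G n
  have hanti := rationalDerivedSeries_antitone G
  let π := QuotientGroup.mk' (rationalDerivedSeries G n)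
  refine ⟨hn, n, fun i => (rationalDerivedSeries G i).map π, ?_, ?_, ?_, ?_, ?_, ?_⟩
  · exact Subgroup.map_top_of_surjective π (QuotientGroup.mk'_surjective _)
  · exact QuotientGroup.map_mk'_self _
  · exact fun i _ => Subgroup.map_mono (hanti i.le_succ)
  · rintro i - _ ⟨x, -, rfl⟩ _ ⟨y, hy, rfl⟩
    exact ⟨x * y * x⁻¹, (rationalDerivedSeries_normal G (i + 1)).conj_mem y hy x, by simp⟩
  · rintro i - _ ⟨x, hx, rfl⟩ _ ⟨y, hy, rfl⟩
    exact ⟨x * y * x⁻¹ * y⁻¹, commutator_mem_rationalDerivedSeries_succ hx hy, by simp⟩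
  · rintro i hi _ ⟨x, hx, rfl⟩ m hm ⟨y, hy, hyx⟩
    refine ⟨x, mem_rationalDerivedSeries_succ_of_pow_mem hm hx ?_, rfl⟩
    rw [← map_pow] at hyx
    have h : y⁻¹ * x ^ m ∈ rationalDerivedSeries G n := QuotientGroup.eq.1 hyx
    simpa using mul_mem hy (hanti hi h)
end

section
/- Let G be a group, N a normal subgroup of G, and R a commutative ring. Let R[G/N] denote the representation of G over R whose underlying module is the free R-module on the coset space G/N, with G acting by left translation of cosets. Then the first group homology H₁(G; R[G/N]) is isomorphic as an R-module to (N/[N,N]) ⊗_ℤ R. In particular, H₁(G; ℤ[G/N]) is isomorphic to the abelianization N/[N,N]. -/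
open LinearMap

section GroupHomology

variable {R : Type*} [CommRing R] {G : Type*} [Group G]
  {A : Type*} [AddCommGroup A] [Module R A]

/-- The differential `C₁ = ℤ[G] ⊗ A → C₀ = A` of the inhomogeneous bar complex computing
group homology: `[g] ⊗ a ↦ ρ(g⁻¹)(a) − a`. -/
noncomputable def barD1 (ρ : Representation R G A) : (G →₀ A) →ₗ[R] A :=
  Finsupp.lsum ℕ fun g => ρ g⁻¹ - LinearMap.id

/-- The differential `C₂ = ℤ[G²] ⊗ A → C₁ = ℤ[G] ⊗ A` of the inhomogeneous bar complex:
`[g|h] ⊗ a ↦ [h] ⊗ ρ(g⁻¹)(a) − [gh] ⊗ a + [g] ⊗ a`. -/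
noncomputable def barD2 (ρ : Representation R G A) : (G × G →₀ A) →ₗ[R] (G →₀ A) :=
  Finsupp.lsum ℕ fun gh =>
    (Finsupp.lsingle gh.2).comp (ρ gh.1⁻¹) - Finsupp.lsingle (gh.1 * gh.2)
      + Finsupp.lsingle gh.1

/-- The first group homology `H₁(G; A)` of `G` with coefficients in the representation `ρ`,
defined as the quotient of the 1-cycles by the 1-boundaries of the bar complex. -/
noncomputable abbrev groupHomology1 (ρ : Representation R G A) :=
  LinearMap.ker (barD1 ρ) ⧸
    (LinearMap.range (barD2 ρ)).comap (LinearMap.ker (barD1 ρ)).subtype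

end GroupHomology

/-- The `R`-module structure on `M ⊗_ℤ R` coming from multiplication on the right-hand tensor
factor. -/
noncomputable instance tensorRightModule (M : Type*) [AddCommGroup M]
    (R : Type*) [CommRing R] : Module R (TensorProduct ℤ M R) where
  smul r x := LinearMap.lTensor M (r • (LinearMap.id : R →ₗ[ℤ] R)) x
  one_smul x := by
    show LinearMap.lTensor M ((1 : R) • (LinearMap.id : R →ₗ[ℤ] R)) x = x
    rw [one_smul, LinearMap.lTensor_id]
    rfl
  mul_smul r s x := by
    show LinearMap.lTensor M ((r * s) • (LinearMap.id : R →ₗ[ℤ] R)) x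
      = LinearMap.lTensor M (r • (LinearMap.id : R →ₗ[ℤ] R))
          (LinearMap.lTensor M (s • (LinearMap.id : R →ₗ[ℤ] R)) x)
    have h : ((r * s) • (LinearMap.id : R →ₗ[ℤ] R))
        = (r • (LinearMap.id : R →ₗ[ℤ] R)).comp (s • (LinearMap.id : R →ₗ[ℤ] R)) := by
      ext a; simp [smul_smul, mul_assoc]
    rw [h, LinearMap.lTensor_comp]
    rfl
  smul_zero r := map_zero _
  smul_add r x y := map_add _ x y
  add_smul r s x := by
    show LinearMap.lTensor M ((r + s) • (LinearMap.id : R →ₗ[ℤ] R)) x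
      = LinearMap.lTensor M (r • (LinearMap.id : R →ₗ[ℤ] R)) x
        + LinearMap.lTensor M (s • (LinearMap.id : R →ₗ[ℤ] R)) x
    rw [add_smul, LinearMap.lTensor_add]
    rfl
  zero_smul x := by
    show LinearMap.lTensor M ((0 : R) • (LinearMap.id : R →ₗ[ℤ] R)) x = 0
    rw [zero_smul, LinearMap.lTensor_zero]
    rfl

section Shapiro

open scoped TensorProduct

variable (R : Type*) [CommRing R] {G : Type*} [Group G] (N : Subgroup G)

/-- The map `r ↦ m ⊗ r`, linear for the module structure on the right-hand factor. -/
noncomputable def tmulRight {M : Type*} [AddCommGroup M] (m : M) : R →ₗ[R] M ⊗[ℤ] R where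
  toFun r := m ⊗ₜ r
  map_add' := TensorProduct.tmul_add m
  map_smul' _ _ := rfl

/-- The element `s(x)⁻¹ g s(g⁻¹x)` of `N`, for `s` the chosen section of `G → G ⧸ N`. -/
noncomputable def cosetTransition (g : G) (x : G ⧸ N) : N :=
  ⟨x.out⁻¹ * (g * (g⁻¹ • x).out), by
    rw [← QuotientGroup.eq, QuotientGroup.out_eq', ← smul_eq_mul, MulAction.Quotient.mk_smul_out,
      smul_inv_smul]⟩

lemma cosetTransition_mul (g h : G) (x : G ⧸ N) :
    cosetTransition N (g * h) x =
      cosetTransition N g x * cosetTransition N h (g⁻¹ • x) := by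
  ext
  simp [cosetTransition, mul_smul, mul_assoc]

/-- The class of an element of `N` in the abelianization, written additively. -/
def abClass (n : N) : Additive (Abelianization N) :=
  Additive.ofMul (Abelianization.of n)

lemma abClass_mul (m n : N) : abClass N (m * n) = abClass N m + abClass N n := by
  simp [abClass]

/-- The map from 1-chains of `G` with coefficients in `R[G/N]` to `(N/[N,N]) ⊗ R` sending
`[g] ⊗ x` to the class of `s(x)⁻¹ g s(g⁻¹x)`. -/
noncomputable def chainsToAbTensor :
    (G →₀ MonoidAlgebra R (G ⧸ N)) →ₗ[R] Additive (Abelianization N) ⊗[ℤ] R :=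
  Finsupp.lsum ℕ fun g =>
    Finsupp.lsum ℕ (fun x => tmulRight R (abClass N (cosetTransition N g x))) ∘ₗ
      (MonoidAlgebra.coeffLinearEquiv R).toLinearMap

lemma chainsToAbTensor_single (g : G) (x : G ⧸ N) (r : R) :
    chainsToAbTensor R N (.single g (.single x r)) =
      abClass N (cosetTransition N g x) ⊗ₜ r := by
  rw [chainsToAbTensor, Finsupp.lsum_single]
  exact Finsupp.lsum_single ℕ _ _ _

lemma barD1_single (g : G) (x : G ⧸ N) (r : R) :
    barD1 (Representation.ofMulAction R G (G ⧸ N)) (.single g (.single x r)) =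
      .single (g⁻¹ • x) r - .single x r := by
  simp [barD1, Representation.ofMulAction_single]

lemma barD2_single (g h : G) (x : G ⧸ N) (r : R) :
    barD2 (Representation.ofMulAction R G (G ⧸ N)) (.single (g, h) (.single x r)) =
      .single h (.single (g⁻¹ • x) r) - .single (g * h) (.single x r)
        + .single g (.single x r) := by
  simp [barD2, Representation.ofMulAction_single]

lemma chainsToAbTensor_comp_barD2 :
    chainsToAbTensor R N ∘ₗ barD2 (Representation.ofMulAction R G (G ⧸ N)) = 0 := by
  refine Finsupp.lhom_ext' fun ⟨g, h⟩ => MonoidAlgebra.lhom_ext' fun x =>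
    LinearMap.ext fun r => ?_
  simp only [LinearMap.comp_apply, MonoidAlgebra.lsingle_apply, Finsupp.lsingle_apply, barD2_single, map_add, map_sub,
    chainsToAbTensor_single, cosetTransition_mul, abClass_mul, TensorProduct.add_tmul,
    LinearMap.zero_apply]
  abel

/-- The 1-chains modulo 1-boundaries of `G` with coefficients in `R[G/N]`. -/
abbrev chainsModBoundaries :=
  (G →₀ MonoidAlgebra R (G ⧸ N)) ⧸ LinearMap.range (barD2 (Representation.ofMulAction R G (G ⧸ N)))

/-- The class of the chain `[g] ⊗ r x` modulo boundaries. -/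
noncomputable def chainClass (g : G) (x : G ⧸ N) : R →ₗ[R] chainsModBoundaries R N :=
  Submodule.mkQ _ ∘ₗ Finsupp.lsingle g ∘ₗ MonoidAlgebra.lsingle x

lemma chainClass_mul (g h : G) (x : G ⧸ N) :
    chainClass R N (g * h) x = chainClass R N g x + chainClass R N h (g⁻¹ • x) := by
  ext
  refine (Submodule.Quotient.eq _).2 (LinearMap.mem_range.2 ⟨-.single (g, h) (.single x 1), ?_⟩)
  rw [map_neg, barD2_single]
  simp only [LinearMap.comp_apply, MonoidAlgebra.lsingle_apply, Finsupp.lsingle_apply]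
  abel

lemma inv_smul_mk_one (n : N) : (n : G)⁻¹ • ((1 : G) : G ⧸ N) = (1 : G) := by
  rw [MulAction.Quotient.smul_coe, QuotientGroup.eq]
  simp

/-- The homomorphism sending `n ∈ N` to the class of the loop `[n] ⊗ N`. -/
noncomputable def loopClassHom : N →* Multiplicative (R →+ chainsModBoundaries R N) :=
  MonoidHom.mk' (fun n => Multiplicative.ofAdd (chainClass R N n (1 : G)).toAddMonoidHom)
    fun m n => by
      rw [Subgroup.coe_mul, chainClass_mul, inv_smul_mk_one]
      rfl

/-- The map `(N/[N,N]) ⊗ R → C₁/B₁` sending `n ⊗ r` to the class of `[n] ⊗ r N`. -/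
noncomputable def abTensorToChains :
    Additive (Abelianization N) ⊗[ℤ] R →+ chainsModBoundaries R N :=
  TensorProduct.liftAddHom (MonoidHom.toAdditiveLeft (Abelianization.lift (loopClassHom R N)))
    fun k m r => by rw [map_zsmul, AddMonoidHom.coe_smul, Pi.smul_apply, map_zsmul]

lemma abTensorToChains_tmul (n : N) (r : R) :
    abTensorToChains R N (abClass N n ⊗ₜ r) = chainClass R N n (1 : G) r :=
  rfl

/-- The map `C₀ → C₁/B₁` sending a coset `x` to the class of `[s(x)] ⊗ x`. -/
noncomputable def sectionPath : MonoidAlgebra R (G ⧸ N) →ₗ[R] chainsModBoundaries R N :=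
  Finsupp.lsum ℕ (fun x => chainClass R N x.out x) ∘ₗ
    (MonoidAlgebra.coeffLinearEquiv R).toLinearMap

lemma sectionPath_single (x : G ⧸ N) (r : R) :
    sectionPath R N (.single x r) = chainClass R N x.out x r := by
  exact Finsupp.lsum_single ℕ _ _ _

lemma out_inv_smul (x : G ⧸ N) : x.out⁻¹ • x = (1 : G) := by
  rw [inv_smul_eq_iff, MulAction.Quotient.smul_coe, smul_eq_mul, mul_one, QuotientGroup.out_eq']

lemma chainClass_add_path (g : G) (x : G ⧸ N) :
    chainClass R N g x + chainClass R N (g⁻¹ • x).out (g⁻¹ • x) =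
      chainClass R N x.out x + chainClass R N (cosetTransition N g x) (1 : G) := by
  rw [← chainClass_mul, ← out_inv_smul N x, ← chainClass_mul]
  simp [cosetTransition]

lemma abTensorToChains_chainsToAbTensor (c : G →₀ MonoidAlgebra R (G ⧸ N)) :
    abTensorToChains R N (chainsToAbTensor R N c) =
      Submodule.Quotient.mk c +
        sectionPath R N (barD1 (Representation.ofMulAction R G (G ⧸ N)) c) := by
  induction c using Finsupp.induction_linear with
  | zero => simp
  | add c d hc hd =>
    simp only [map_add, hc, hd, Submodule.Quotient.mk_add]
    abel
  | single g a =>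
    induction a using MonoidAlgebra.induction_linear with
    | zero => simp
    | add a b ha hb =>
      simp only [Finsupp.single_add, map_add, ha, hb, Submodule.Quotient.mk_add]
      abel
    | single x r =>
      have h := LinearMap.congr_fun (chainClass_add_path R N g x) r
      simp only [LinearMap.add_apply] at h
      rw [chainsToAbTensor_single, abTensorToChains_tmul, barD1_single, map_sub,
        sectionPath_single, sectionPath_single, ← add_sub_assoc, eq_sub_iff_add_eq, add_comm, ← h]
      rfl

lemma abClass_cosetTransition_one (n : N) :
    abClass N (cosetTransition N n (1 : G)) = abClass N n := by
  have h₀ : ((1 : G) : G ⧸ N).out ∈ N := by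
    simpa using QuotientGroup.eq.1 (QuotientGroup.out_eq' ((1 : G) : G ⧸ N)).symm
  have h : cosetTransition N n (1 : G) = ⟨_, h₀⟩⁻¹ * (n * ⟨_, h₀⟩) := by
    ext
    simp only [cosetTransition, inv_smul_mk_one, Subgroup.coe_mul, Subgroup.coe_inv]
  rw [h, abClass, abClass, map_mul Abelianization.of, map_mul Abelianization.of,
    map_inv Abelianization.of, mul_comm (Abelianization.of n), inv_mul_cancel_left]

/-- The map from `H₁(G; R[G/N])` to `(N/[N,N]) ⊗ R` induced by `chainsToAbTensor`. -/
noncomputable def homologyToAbTensor :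
    groupHomology1 (Representation.ofMulAction R G (G ⧸ N)) →ₗ[R]
      Additive (Abelianization N) ⊗[ℤ] R :=
  Submodule.liftQ _ (chainsToAbTensor R N ∘ₗ Submodule.subtype _) <| by
    rintro c ⟨b, hb⟩
    rw [LinearMap.mem_ker, LinearMap.comp_apply, ← hb]
    exact LinearMap.congr_fun (chainsToAbTensor_comp_barD2 R N) b

lemma homologyToAbTensor_injective : Function.Injective (homologyToAbTensor R N) := by
  rw [injective_iff_map_eq_zero]
  intro y hy
  obtain ⟨⟨c, hc⟩, rfl⟩ := Submodule.Quotient.mk_surjective _ y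
  have h := abTensorToChains_chainsToAbTensor R N c
  rw [LinearMap.mem_ker.1 hc, show chainsToAbTensor R N c = 0 from hy, map_zero, map_zero,
    add_zero, eq_comm, Submodule.Quotient.mk_eq_zero] at h
  exact (Submodule.Quotient.mk_eq_zero _).2 h

lemma homologyToAbTensor_surjective : Function.Surjective (homologyToAbTensor R N) := by
  intro t
  induction t using TensorProduct.induction_on with
  | zero => exact ⟨0, map_zero _⟩
  | add s t hs ht =>
    obtain ⟨a, rfl⟩ := hs
    obtain ⟨b, rfl⟩ := ht
    exact ⟨a + b, map_add _ _ _⟩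
  | tmul m r =>
    obtain ⟨n, rfl⟩ : ∃ n, abClass N n = m := QuotientGroup.mk_surjective m
    refine ⟨Submodule.Quotient.mk ⟨.single (n : G) (.single ((1 : G) : G ⧸ N) r), ?_⟩, ?_⟩
    · rw [LinearMap.mem_ker, barD1_single, inv_smul_mk_one, sub_self]
    · refine (chainsToAbTensor_single R N n (1 : G) r).trans ?_
      rw [abClass_cosetTransition_one]

/-- Shapiro's lemma in degree one: `H₁(G; R[G/N]) ≅ (N/[N,N]) ⊗ R`. -/
noncomputable def homologyEquivAbTensor :
    groupHomology1 (Representation.ofMulAction R G (G ⧸ N)) ≃ₗ[R]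
      Additive (Abelianization N) ⊗[ℤ] R :=
  LinearEquiv.ofBijective (homologyToAbTensor R N)
    ⟨homologyToAbTensor_injective R N, homologyToAbTensor_surjective R N⟩

/-- The additive equivalence underlying `homologyEquivAbTensor`. -/
noncomputable def homologyAddEquivAbTensor :
    groupHomology1 (Representation.ofMulAction R G (G ⧸ N)) ≃+
      Additive (Abelianization N) ⊗[ℤ] R :=
  (homologyEquivAbTensor R N).toAddEquiv

end Shapiro

/-- Let `N` be a normal subgroup of `G` and `R` a commutative ring, and let `R[G/N]` be the
free `R`-module on the coset space `G/N` with `G` acting by left translation.  Then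
`H₁(G; R[G/N]) ≅ (N/[N,N]) ⊗_ℤ R` as `R`-modules; in particular `H₁(G; ℤ[G/N])` is isomorphic
to the abelianization `N/[N,N]`. -/
theorem groupHomology1_ofMulAction_quotient (G : Type*) [Group G] (N : Subgroup G)
    (hN : N.Normal) (R : Type*) [CommRing R] :
    Nonempty (groupHomology1 (Representation.ofMulAction R G (G ⧸ N)) ≃ₗ[R]
      TensorProduct ℤ (Additive (Abelianization N)) R) ∧
    Nonempty (groupHomology1 (Representation.ofMulAction ℤ G (G ⧸ N)) ≃+
      Additive (Abelianization N)) :=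
  ⟨⟨homologyEquivAbTensor R N⟩,
    ⟨(homologyAddEquivAbTensor ℤ N).trans (TensorProduct.rid ℤ _).toAddEquiv⟩⟩
end
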